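/- arXiv:1509.04376 — 4 statements merged into one kernel-verified Lean document; each statement's English description precedes it below -/
import Mathlib

section
/- For every integer n ≥ 2 and every nonzero x ∈ ℝⁿ, the subdifferential ∂f(x) of the total variation seminorm f(x) = ‖Bx‖₁ satisfies the weak decomposability assumption: there exists w₀ ∈ ∂f(x) such that ⟨w − w₀, w₀⟩ = 0 simultaneously for all w ∈ ∂f(x). -/
open Matrix

/-- Index `i` of `Fin (n-1)` viewed in `Fin n`. -/
def fdIdx0 {n : ℕ} (i : Fin (n - 1)) : Fin n := ⟨i.val, by have h := i.isLt; omega⟩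

/-- Index `i+1` of `Fin (n-1)` viewed in `Fin n`. -/
def fdIdx1 {n : ℕ} (i : Fin (n - 1)) : Fin n := ⟨i.val + 1, by have h := i.isLt; omega⟩

/-- The total variation seminorm `f(x) = ‖Bx‖₁`. -/
def tv {n : ℕ} (B : Matrix (Fin (n - 1)) (Fin n) ℝ) (z : Fin n → ℝ) : ℝ :=
  ∑ i, |B.mulVec z i|

/-- The subdifferential of the total variation seminorm at `x`. -/
def tvSubdiff {n : ℕ} (B : Matrix (Fin (n - 1)) (Fin n) ℝ) (x : Fin n → ℝ) :
    Set (Fin n → ℝ) :=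
  {w | ∀ y : Fin n → ℝ, tv B y ≥ tv B x + w ⬝ᵥ (y - x)}

/-- Piecewise linear interpolation of `σ` between the points of an unbounded set (and `0`)
preserves a bound on `|σ|`, agrees with `σ` on that set and has vanishing second differences
off it. -/
lemma exists_piecewise_linear_interpolation (P : ℕ → Prop)
    (hP : ∀ i, ∃ q, i < q ∧ P q) (σ : ℕ → ℝ) (hσ : ∀ i, |σ i| ≤ 1) :
    ∃ s : ℕ → ℝ, (∀ i, |s i| ≤ 1) ∧ (∀ i, P i → s i = σ i) ∧
      ∀ i, ¬ P (i + 1) → s (i + 2) - s (i + 1) = s (i + 1) - s i := by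
  classical
  let p : ℕ → ℕ := fun i => Nat.findGreatest P i
  let q : ℕ → ℕ := fun i => Nat.find (hP i)
  have hp_le (i : ℕ) : p i ≤ i := Nat.findGreatest_le i
  have hp_of_mem (i : ℕ) (h : P i) : p i = i := Nat.findGreatest_eq h
  have hp_succ (i : ℕ) (h : ¬ P (i + 1)) : p (i + 1) = p i := Nat.findGreatest_of_not h
  have hq_lt (i : ℕ) : i < q i := (Nat.find_spec (hP i)).1
  have hq_mem (i : ℕ) : P (q i) := (Nat.find_spec (hP i)).2
  have hq_min (i j : ℕ) (h : i < j) (hj : P j) : q i ≤ j := Nat.find_min' (hP i) ⟨h, hj⟩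
  have hq_succ (i : ℕ) (h : ¬ P (i + 1)) : q (i + 1) = q i := by
    apply le_antisymm
    · refine hq_min _ _ (lt_of_le_of_ne (hq_lt i) fun e => h ?_) (hq_mem i)
      rw [e]
      exact hq_mem i
    · exact hq_min _ _ (by have := hq_lt (i + 1); omega) (hq_mem (i + 1))
  let s : ℕ → ℝ := fun i =>
    σ (p i) + (σ (q i) - σ (p i)) * (((i : ℝ) - p i) / ((q i : ℝ) - p i))
  have hs_mem (i : ℕ) (h : P i) : s i = σ i := by
    simp [s, hp_of_mem i h]
  have hpq (i : ℕ) : (0 : ℝ) < (q i : ℝ) - p i :=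
    sub_pos.2 (by exact_mod_cast (hp_le i).trans_lt (hq_lt i))
  have hs_succ (i : ℕ) :
      s (i + 1) - s i = (σ (q i) - σ (p i)) / ((q i : ℝ) - p i) := by
    have hne := (hpq i).ne'
    by_cases h : P (i + 1)
    · have hq : q i = i + 1 := le_antisymm (hq_min _ _ (Nat.lt_succ_self i) h) (hq_lt i)
      rw [hs_mem _ h]
      simp only [s]
      rw [hq] at hne ⊢
      push_cast at hne ⊢
      field_simp
      ring
    · simp only [s, hp_succ i h, hq_succ i h]
      push_cast
      field_simp
      ring
  refine ⟨s, fun i => ?_, hs_mem, fun i h => ?_⟩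
  · have ht0 : 0 ≤ ((i : ℝ) - p i) / ((q i : ℝ) - p i) :=
      div_nonneg (sub_nonneg.2 (by exact_mod_cast hp_le i)) (hpq i).le
    have ht1 : ((i : ℝ) - p i) / ((q i : ℝ) - p i) ≤ 1 := by
      rw [div_le_one (hpq i)]
      have : (i : ℝ) ≤ q i := by exact_mod_cast (hq_lt i).le
      linarith
    have h1 := abs_le.1 (hσ (p i))
    have h2 := abs_le.1 (hσ (q i))
    simp only [s]
    rw [abs_le]
    constructor <;> nlinarith
  · rw [hs_succ (i + 1), hs_succ i, hp_succ i h, hq_succ i h]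

/-- Near `t = 0`, the absolute value is affine along a direction that vanishes where the base
point does. -/
lemma eventually_abs_add_mul_eq (a b : ℝ) (h : a = 0 → b = 0) :
    ∀ᶠ t in nhds (0 : ℝ), |a + t * b| = |a| + t * (SignType.sign a * b) := by
  have hc : Filter.Tendsto (fun t : ℝ => a + t * b) (nhds 0) (nhds a) := by
    have : Continuous fun t : ℝ => a + t * b := by fun_prop
    simpa using this.tendsto 0
  rcases lt_trichotomy a 0 with ha | rfl | ha
  · filter_upwards [hc.eventually_lt_const ha] with t ht
    simp [abs_of_neg ht, abs_of_neg ha, sign_neg ha]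
    ring
  · simp [h rfl]
  · filter_upwards [hc.eventually_const_lt ha] with t ht
    simp [abs_of_pos ht, abs_of_pos ha, sign_pos ha]

/-- All subgradients at `x` have the same inner product with a direction `v` such that `Bv`
vanishes wherever `Bx` does. -/
lemma dotProduct_eq_of_mem_tvSubdiff {n : ℕ} (B : Matrix (Fin (n - 1)) (Fin n) ℝ)
    (x v : Fin n → ℝ) (h : ∀ i, B.mulVec x i = 0 → B.mulVec v i = 0)
    {w : Fin n → ℝ} (hw : w ∈ tvSubdiff B x) :
    w ⬝ᵥ v = ∑ i, (SignType.sign (B.mulVec x i) : ℝ) * B.mulVec v i := by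
  have hev : ∀ᶠ t in nhds (0 : ℝ), ∀ i, |B.mulVec x i + t * B.mulVec v i| =
      |B.mulVec x i| + t * (SignType.sign (B.mulVec x i) * B.mulVec v i) :=
    Filter.eventually_all.2 fun i => eventually_abs_add_mul_eq _ _ (h i)
  obtain ⟨ε, hε, hball⟩ := Metric.eventually_nhds_iff.1 hev
  have key (t : ℝ) (ht : |t| < ε) : t * (w ⬝ᵥ v) ≤
      t * ∑ i, (SignType.sign (B.mulVec x i) : ℝ) * B.mulVec v i := by
    have h1 := hw (x + t • v)
    have h2 : tv B (x + t • v) =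
        tv B x + t * ∑ i, (SignType.sign (B.mulVec x i) : ℝ) * B.mulVec v i := by
      simp only [tv, Finset.mul_sum, ← Finset.sum_add_distrib]
      refine Finset.sum_congr rfl fun i _ => ?_
      rw [← hball (by simpa using ht) i]
      simp [Matrix.mulVec_add, Matrix.mulVec_smul]
    rw [h2] at h1
    simp only [add_sub_cancel_left, dotProduct_smul, smul_eq_mul] at h1
    linarith
  have hpos := key (ε / 2) (by rw [abs_of_pos (by positivity)]; linarith)
  have hneg := key (-(ε / 2)) (by rw [abs_neg, abs_of_pos (by positivity)]; linarith)
  nlinarith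

/-- Summation by parts with vanishing boundary values. -/
lemma sum_diff_mul_eq_sum_mul_diff (m : ℕ) (s : ℕ → ℝ) (h0 : s 0 = 0) (hm : s (m + 1) = 0)
    (y : Fin (m + 1) → ℝ) :
    ∑ j : Fin (m + 1), (s (j + 1) - s j) * y j =
      ∑ i : Fin m, s (i + 1) * (y i.castSucc - y i.succ) := by
  simp only [sub_mul, mul_sub, Finset.sum_sub_distrib]
  rw [Fin.sum_univ_castSucc, Fin.sum_univ_succ (fun j : Fin (m + 1) => s j * y j)]
  simp [h0, hm]

lemma mulVec_finite_difference {m : ℕ} (B : Matrix (Fin m) (Fin (m + 1)) ℝ)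
    (hB : ∀ i j, B i j = if j = i.castSucc then 1 else if j = i.succ then -1 else 0)
    (z : Fin (m + 1) → ℝ) (i : Fin m) : B.mulVec z i = z i.castSucc - z i.succ := by
  have hne : i.succ ≠ i.castSucc := (Fin.castSucc_lt_succ (i := i)).ne'
  have hsplit (j : Fin (m + 1)) : B i j * z j =
      (if j = i.castSucc then z j else 0) - (if j = i.succ then z j else 0) := by
    rw [hB]
    split_ifs with h1 h2
    · exact absurd (h2.symm.trans h1) hne
    all_goals simp
  simp [Matrix.mulVec, dotProduct, hsplit, Finset.sum_sub_distrib]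

/-- For every `n ≥ 2` and every nonzero `x ∈ ℝⁿ`, the subdifferential `∂f(x)` of the total
variation seminorm `f(x) = ‖Bx‖₁` satisfies the weak decomposability assumption: there exists
`w₀ ∈ ∂f(x)` such that `⟨w − w₀, w₀⟩ = 0` simultaneously for all `w ∈ ∂f(x)`. -/
theorem tv_weak_decomposability (n : ℕ) (hn : 2 ≤ n)
    (B : Matrix (Fin (n - 1)) (Fin n) ℝ)
    (hB : ∀ (i : Fin (n - 1)) (j : Fin n),
      B i j = if j = fdIdx0 i then 1 else if j = fdIdx1 i then -1 else 0)
    (x : Fin n → ℝ) (hx : x ≠ 0) :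
    ∃ w₀ ∈ tvSubdiff B x, ∀ w ∈ tvSubdiff B x, (w - w₀) ⬝ᵥ w₀ = 0 := by
  obtain ⟨m, rfl⟩ : ∃ m, n = m + 1 := ⟨n - 1, by omega⟩
  have hBz : ∀ (z : Fin (m + 1) → ℝ) (i : Fin m), B.mulVec z i = z i.castSucc - z i.succ :=
    mulVec_finite_difference B hB
  let σ : ℕ → ℝ := fun k => k.casesOn 0 fun i =>
    if h : i < m then (SignType.sign (B.mulVec x ⟨i, h⟩) : ℝ) else 0
  have hσ_succ (i : Fin m) : σ (i + 1) = SignType.sign (B.mulVec x i) := by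
    simp [σ]
  have hσ_last : σ (m + 1) = 0 := by simp [σ]
  have hσ_abs (k : ℕ) : |σ k| ≤ 1 := by
    rcases k with _ | i
    · simp [σ]
    · by_cases h : i < m
      · rw [hσ_succ ⟨i, h⟩]
        cases SignType.sign (B.mulVec x ⟨i, h⟩) <;> simp
      · simp [σ, h]
  obtain ⟨s, hs_abs, hs_eq, hs_lin⟩ := exists_piecewise_linear_interpolation
    (fun k => k = 0 ∨ m < k ∨ σ k ≠ 0)
    (fun i => ⟨i + m + 1, by omega, Or.inr (Or.inl (by omega))⟩) σ hσ_abs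
  have hs_zero : s 0 = 0 := hs_eq 0 (Or.inl rfl)
  have hs_last : s (m + 1) = 0 := by
    rw [hs_eq (m + 1) (Or.inr (Or.inl (Nat.lt_succ_self m))), hσ_last]
  let w₀ : Fin (m + 1) → ℝ := fun j => s (j + 1) - s j
  have hw₀_dot (y : Fin (m + 1) → ℝ) :
      w₀ ⬝ᵥ y = ∑ i : Fin m, s (i + 1) * B.mulVec y i := by
    simp only [hBz]
    exact sum_diff_mul_eq_sum_mul_diff m s hs_zero hs_last y
  have hw₀_mem : w₀ ∈ tvSubdiff B x := by
    intro y
    have hx_eq : w₀ ⬝ᵥ x = tv B x := by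
      rw [hw₀_dot]
      refine Finset.sum_congr rfl fun i _ => ?_
      by_cases h : B.mulVec x i = 0
      · simp [h]
      · rw [hs_eq (i + 1) (Or.inr (Or.inr (by
          rw [hσ_succ]
          rcases lt_or_gt_of_ne h with h | h <;> simp [sign_neg, sign_pos, h]))), hσ_succ]
        exact sign_mul_self _
    have hy_le : w₀ ⬝ᵥ y ≤ tv B y := by
      rw [hw₀_dot]
      refine Finset.sum_le_sum fun i _ => (le_abs_self _).trans ?_
      rw [abs_mul]
      exact mul_le_of_le_one_left (abs_nonneg _) (hs_abs _)
    rw [dotProduct_sub, hx_eq]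
    linarith
  have hw₀_flat (i : Fin m) (h : B.mulVec x i = 0) : B.mulVec w₀ i = 0 := by
    have hlin := hs_lin i (by
      rintro (h0 | hlt | hne)
      · omega
      · omega
      · exact hne (by simp [hσ_succ, h]))
    rw [hBz]
    simp only [w₀, Fin.val_castSucc, Fin.val_succ]
    linarith
  refine ⟨w₀, hw₀_mem, fun w hw => ?_⟩
  rw [sub_dotProduct, dotProduct_eq_of_mem_tvSubdiff B x w₀ hw₀_flat hw,
    dotProduct_eq_of_mem_tvSubdiff B x w₀ hw₀_flat hw₀_mem, sub_self]
end

section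
/- Let n ≥ 2, let x ∈ ℝⁿ be nonzero, and let S = {i ∈ {1,…,n−1} : x_i = x_{i+1}}. Then there exists a vector v₀ ∈ ℝ^{n−1} such that: (i) |（v₀)_i| ≤ 1 for every i ∈ {1,…,n−1}; (ii) for every i ∉ S, (v₀)_i = 1 if x_{i+1} < x_i and (v₀)_i = −1 if x_{i+1} > x_i; and (iii) (B Bᵀ v₀)_i = 0 for every i ∈ S. -/
open Matrix

/-- Piecewise linear interpolation on `{0, …, m}`: given values `g k` in `[-1, 1]` at the nodes
`k` satisfying `F`, there is a function with values in `[-1, 1]` that agrees with `g` at the nodes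
and whose second difference vanishes away from them. -/
theorem exists_piecewise_linear_interpolation_s1 (F : ℕ → Prop) (g : ℕ → ℝ) (h0 : F 0)
    (hg : ∀ k, |g k| ≤ 1) (m : ℕ) (hm : F m) :
    ∃ w : ℕ → ℝ, (∀ k ≤ m, |w k| ≤ 1) ∧ (∀ k ≤ m, F k → w k = g k) ∧
      ∀ k, k + 1 < m → ¬ F (k + 1) → 2 * w (k + 1) = w k + w (k + 2) := by
  classical
  induction m using Nat.strong_induction_on with
  | _ m ih =>
  rcases Nat.eq_zero_or_pos m with rfl | hpos
  · exact ⟨g, fun k _ => hg k, fun k _ _ => rfl, fun k hk => by omega⟩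
  obtain ⟨p, hpm, hp, hmax⟩ : ∃ p, p < m ∧ F p ∧ ∀ k, p < k → k < m → ¬ F k := by
    refine ⟨Nat.findGreatest F (m - 1), ?_, Nat.findGreatest_spec (Nat.zero_le _) h0, ?_⟩
    · have := Nat.findGreatest_le (P := F) (m - 1)
      omega
    · exact fun k hk hkm => Nat.findGreatest_is_greatest hk (by omega)
  obtain ⟨w, hw1, hwF, hwh⟩ := ih p hpm hp
  have hd : (0 : ℝ) < m - p := sub_pos.2 (by exact_mod_cast hpm)
  set l : ℕ → ℝ := fun k => g p + (g m - g p) * ((k - p) / (m - p)) with hl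
  have hlp : l p = g p := by simp [hl]
  have hlm : l m = g m := by simp [hl, div_self hd.ne']
  have hlh : ∀ k, 2 * l (k + 1) = l k + l (k + 2) := fun k => by
    simp only [hl]; push_cast; ring
  have hle : ∀ k, p ≤ k → k ≤ m → |l k| ≤ 1 := fun k hpk hkm => by
    have hpk' : (p : ℝ) ≤ k := by exact_mod_cast hpk
    have hkm' : (k : ℝ) ≤ m := by exact_mod_cast hkm
    have ht0 : 0 ≤ ((k : ℝ) - p) / (m - p) := div_nonneg (by linarith) hd.le
    have ht1 : ((k : ℝ) - p) / (m - p) ≤ 1 := (div_le_one hd).2 (by linarith)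
    obtain ⟨h1, h2⟩ := abs_le.1 (hg p)
    obtain ⟨h3, h4⟩ := abs_le.1 (hg m)
    simp only [hl]
    exact abs_le.2 ⟨by nlinarith, by nlinarith⟩
  refine ⟨fun k => if k ≤ p then w k else l k, fun k hk => ?_, fun k hk hF => ?_,
    fun k hk hF => ?_⟩
  · dsimp only
    split_ifs with h
    · exact hw1 k h
    · exact hle k (by omega) hk
  · dsimp only
    split_ifs with h
    · exact hwF k h hF
    · obtain rfl : k = m := by
        by_contra hne
        exact hmax k (by omega) (by omega) hF
      exact hlm
  · dsimp only
    rcases lt_trichotomy (k + 1) p with h | h | h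
    · rw [if_pos (by omega), if_pos (by omega), if_pos (by omega)]
      exact hwh k h hF
    · exact absurd (h ▸ hp) hF
    · rw [if_neg (show ¬ k + 1 ≤ p by omega), if_neg (show ¬ k + 2 ≤ p by omega), hlh]
      split_ifs with h'
      · obtain rfl : k = p := by omega
        rw [hlp, hwF k le_rfl hp]
      · rfl

/-- The transposed finite difference matrix takes differences after extension by zero. -/
theorem transpose_finite_difference_mulVec {n : ℕ} (B : Matrix (Fin (n - 1)) (Fin n) ℝ)
    (hB : ∀ (i : Fin (n - 1)) (j : Fin n),
      B i j = if j = fdIdx0 i then 1 else if j = fdIdx1 i then -1 else 0)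
    (w : ℕ → ℝ) (hw0 : w 0 = 0) (hwn : w n = 0) (j : Fin n) :
    (Bᵀ *ᵥ fun i => w (i + 1)) j = w (j + 1) - w j := by
  have hterm : ∀ i : Fin (n - 1), Bᵀ j i * w (i + 1) =
      (if (j : ℕ) = i then w (i + 1) else 0) - if (j : ℕ) = i + 1 then w (i + 1) else 0 := by
    intro i
    rw [transpose_apply, hB]
    simp only [fdIdx0, fdIdx1, Fin.ext_iff]
    split_ifs <;> first | omega | simp
  obtain ⟨j, hj⟩ := j
  simp only [mulVec, dotProduct, hterm]
  rw [Fin.sum_univ_eq_sum_range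
    (fun i => (if j = i then w (i + 1) else 0) - if j = i + 1 then w (i + 1) else 0),
    Finset.sum_sub_distrib, Finset.sum_ite_eq]
  congr 1
  · split_ifs with h
    · rfl
    · rw [Finset.mem_range] at h
      rw [show j + 1 = n by omega, hwn]
  · cases j with
    | zero => simp [hw0]
    | succ j =>
      simp only [Nat.add_right_cancel_iff]
      rw [Finset.sum_ite_eq, if_pos (Finset.mem_range.2 (by omega))]

/-- The finite difference matrix takes differences of consecutive entries. -/
theorem finite_difference_mulVec {n : ℕ} (B : Matrix (Fin (n - 1)) (Fin n) ℝ)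
    (hB : ∀ (i : Fin (n - 1)) (j : Fin n),
      B i j = if j = fdIdx0 i then 1 else if j = fdIdx1 i then -1 else 0)
    (u : Fin n → ℝ) (i : Fin (n - 1)) :
    (B *ᵥ u) i = u (fdIdx0 i) - u (fdIdx1 i) := by
  have hterm : ∀ j : Fin n, B i j * u j =
      (if j = fdIdx0 i then u j else 0) - if j = fdIdx1 i then u j else 0 := by
    intro j
    rw [hB]
    simp only [fdIdx0, fdIdx1, Fin.ext_iff]
    split_ifs <;> first | omega | simp
  simp [mulVec, dotProduct, hterm, Finset.sum_sub_distrib]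

/-- Let `n ≥ 2`, let `x ∈ ℝⁿ` be nonzero, and let `S = {i : x_i = x_{i+1}}`. Then there exists
`v₀ ∈ ℝ^{n−1}` such that: (i) `|(v₀)_i| ≤ 1` for every `i`; (ii) for every `i ∉ S`,
`(v₀)_i = 1` if `x_{i+1} < x_i` and `(v₀)_i = −1` if `x_{i+1} > x_i`; and
(iii) `(B Bᵀ v₀)_i = 0` for every `i ∈ S`. -/
theorem tv_exists_v0 (n : ℕ) (hn : 2 ≤ n)
    (B : Matrix (Fin (n - 1)) (Fin n) ℝ)
    (hB : ∀ (i : Fin (n - 1)) (j : Fin n),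
      B i j = if j = fdIdx0 i then 1 else if j = fdIdx1 i then -1 else 0)
    (x : Fin n → ℝ) (hx : x ≠ 0) :
    ∃ v₀ : Fin (n - 1) → ℝ,
      (∀ i : Fin (n - 1), |v₀ i| ≤ 1) ∧
      (∀ i : Fin (n - 1),
        (x (fdIdx1 i) < x (fdIdx0 i) → v₀ i = 1) ∧
        (x (fdIdx0 i) < x (fdIdx1 i) → v₀ i = -1)) ∧
      (∀ i : Fin (n - 1), x (fdIdx0 i) = x (fdIdx1 i) → (B * Bᵀ).mulVec v₀ i = 0) := by
  classical
  set y : ℕ → ℝ := fun k => if h : k < n then x ⟨k, h⟩ else 0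
  have hy0 : ∀ i : Fin (n - 1), y i = x (fdIdx0 i) := fun i => dif_pos (fdIdx0 i).isLt
  have hy1 : ∀ i : Fin (n - 1), y (i + 1) = x (fdIdx1 i) := fun i => dif_pos (fdIdx1 i).isLt
  set g : ℕ → ℝ := fun k => if k = 0 ∨ k = n then 0 else
    if y k < y (k - 1) then 1 else -1 with hgdef
  have hg : ∀ k, |g k| ≤ 1 := fun k => by
    simp only [hgdef]
    split_ifs <;> simp
  obtain ⟨w, hw1, hwF, hwh⟩ := exists_piecewise_linear_interpolation_s1
    (fun k => k = 0 ∨ k = n ∨ y (k - 1) ≠ y k) g (Or.inl rfl) hg n (Or.inr (Or.inl rfl))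
  have hw0 : w 0 = 0 := by rw [hwF 0 (Nat.zero_le _) (Or.inl rfl)]; simp [hgdef]
  have hwn : w n = 0 := by rw [hwF n le_rfl (Or.inr (Or.inl rfl))]; simp [hgdef]
  have hwi : ∀ i : Fin (n - 1), x (fdIdx0 i) ≠ x (fdIdx1 i) →
      w (i + 1) = if x (fdIdx1 i) < x (fdIdx0 i) then 1 else -1 := fun i hne => by
    have hi := i.isLt
    rw [hwF (i + 1) (by omega) (Or.inr (Or.inr (by simpa [hy0, hy1] using hne)))]
    simp only [hgdef]
    rw [if_neg (by omega), Nat.add_sub_cancel, hy0, hy1]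
  refine ⟨fun i => w (i + 1), fun i => hw1 _ (by omega), fun i => ⟨fun h => ?_, fun h => ?_⟩,
    fun i h => ?_⟩
  · exact (hwi i h.ne').trans (if_pos h)
  · exact (hwi i h.ne).trans (if_neg h.not_gt)
  · have hi := i.isLt
    have hharm := hwh i (by omega) (by
      rintro (h' | h' | h')
      · omega
      · omega
      · exact h' (by rw [Nat.add_sub_cancel, hy0, hy1, h]))
    rw [← mulVec_mulVec, finite_difference_mulVec B hB,
      transpose_finite_difference_mulVec B hB w hw0 hwn,
      transpose_finite_difference_mulVec B hB w hw0 hwn]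
    simp only [fdIdx0, fdIdx1]
    linarith
end

section
/- Let n ≥ 2, let x ∈ ℝⁿ be nonzero, let S = {i ∈ {1,…,n−1} : x_i = x_{i+1}} be nonempty with complement S^c = {1,…,n−1} \ S, and let M = ((B Bᵀ)_{S,S})^{−1} (B Bᵀ)_{S,S^c} ∈ ℝ^{|S|×|S^c|}. Then every entry of M lies in [−1, 0], every row of M has at most two nonzero entries, and every row sum of M lies in [−1, 0]; consequently, for every u ∈ ℝ^{|S^c|} with ‖u‖_∞ ≤ 1, one has ‖M u‖_∞ ≤ 1. -/
open Matrix

/-- Weights of discrete harmonic extension: given boundary points `Q` including `0` and `n`, the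
affine interpolation between the two nearest boundary points is harmonic off `Q`. -/
theorem exists_harmonic_interpolation (n : ℕ) (Q : ℕ → Prop) (h0 : Q 0) (hn : Q n) :
    ∃ (lo hi : ℕ → ℕ) (s : ℕ → ℝ), ∀ k ≤ n, 0 ≤ s k ∧ s k ≤ 1 ∧
      ∀ g : ℕ → ℝ,
        (Q k → (1 - s k) * g (lo k) + s k * g (hi k) = g k) ∧
        (¬ Q k → 2 * ((1 - s k) * g (lo k) + s k * g (hi k)) =
          ((1 - s (k - 1)) * g (lo (k - 1)) + s (k - 1) * g (hi (k - 1))) +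
          ((1 - s (k + 1)) * g (lo (k + 1)) + s (k + 1) * g (hi (k + 1)))) := by
  classical
  have hlo : ∀ k, ∃ a ≤ k, Q a ∧ ∀ m, a < m → m ≤ k → ¬ Q m := fun k =>
    ⟨Nat.findGreatest Q k, Nat.findGreatest_le k, Nat.findGreatest_spec (Nat.zero_le k) h0,
      fun m hm hk => Nat.findGreatest_is_greatest hm hk⟩
  have hhi : ∀ k, ∃ b, k ≤ n → k ≤ b ∧ b ≤ n ∧ Q b ∧ ∀ m, k ≤ m → m < b → ¬ Q m := by
    intro k
    by_cases hk : k ≤ n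
    · have hex : ∃ m, k ≤ m ∧ Q m := ⟨n, hk, hn⟩
      exact ⟨Nat.find hex, fun _ => ⟨(Nat.find_spec hex).1, Nat.find_min' hex ⟨hk, hn⟩,
        (Nat.find_spec hex).2, fun m hm hlt hq => Nat.find_min hex hlt ⟨hm, hq⟩⟩⟩
    · exact ⟨0, fun h => absurd h hk⟩
  choose lo hlo_le hlo_Q hlo_max using hlo
  choose hi hhi using hhi
  have hQ : ∀ k ≤ n, Q k → lo k = k ∧ hi k = k := by
    intro k hk hq
    obtain ⟨h1, -, -, h2⟩ := hhi k hk
    refine ⟨?_, ?_⟩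
    · by_contra hne
      exact hlo_max k k (lt_of_le_of_ne (hlo_le k) hne) le_rfl hq
    · by_contra hne
      exact h2 k le_rfl (lt_of_le_of_ne h1 (Ne.symm hne)) hq
  let s : ℕ → ℝ := fun k => ((k : ℝ) - lo k) / ((hi k : ℝ) - lo k)
  have hblock : ∀ a b k : ℕ, b ≤ n → Q a → Q b → (∀ m, a < m → m < b → ¬ Q m) → a ≤ k → k ≤ b →
      a < b → ∀ g : ℕ → ℝ, (1 - s k) * g (lo k) + s k * g (hi k) =
        (((b : ℝ) - k) * g a + ((k : ℝ) - a) * g b) / ((b : ℝ) - a) := by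
    intro a b k hbn hqa hqb hab hak hkb hlt g
    have hba : (b : ℝ) - a ≠ 0 := sub_ne_zero.mpr (by exact_mod_cast hlt.ne')
    by_cases hq : Q k
    · obtain ⟨e1, e2⟩ := hQ k (hkb.trans hbn) hq
      have hk : k = a ∨ k = b := by
        by_contra hcon
        exact hab k (by omega) (by omega) hq
      simp only [s, e1, e2, sub_self, zero_div]
      rcases hk with rfl | rfl
      · field_simp; ring
      · field_simp; ring
    · have hka : a < k := lt_of_le_of_ne hak (by rintro rfl; exact hq hqa)
      have hkb' : k < b := lt_of_le_of_ne hkb (by rintro rfl; exact hq hqb)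
      obtain ⟨h1, -, h3, h4⟩ := hhi k (hkb.trans hbn)
      have e1 : lo k = a := by
        have := hlo_le k
        rcases lt_trichotomy (lo k) a with h | h | h
        · exact absurd hqa (hlo_max k a h hak)
        · exact h
        · exact absurd (hlo_Q k) (hab _ h (by omega))
      have e2 : hi k = b := by
        rcases lt_trichotomy (hi k) b with h | h | h
        · exact absurd h3 (hab _ (by omega) h)
        · exact h
        · exact absurd hqb (h4 b hkb h)
      simp only [s, e1, e2]
      field_simp
      ring
  refine ⟨lo, hi, s, fun k hk => ?_⟩
  obtain ⟨h1, h2, h3, h4⟩ := hhi k hk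
  have hl := hlo_le k
  have hl' : (lo k : ℝ) ≤ k := by exact_mod_cast hl
  have h1' : (k : ℝ) ≤ hi k := by exact_mod_cast h1
  refine ⟨div_nonneg (by linarith) (by linarith),
    div_le_one_of_le₀ (by linarith) (by linarith), fun g => ⟨fun hq => ?_, fun hq => ?_⟩⟩
  · obtain ⟨e1, e2⟩ := hQ k hk hq
    rw [e1, e2]; ring
  · have hlk : lo k < k := lt_of_le_of_ne hl (fun h => hq (h ▸ hlo_Q k))
    have hkh : k < hi k := lt_of_le_of_ne h1 (fun h => hq (h ▸ h3))
    have hfree : ∀ m, lo k < m → m < hi k → ¬ Q m := fun m hm hm' =>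
      (le_total m k).elim (hlo_max k m hm) (fun h => h4 m h hm')
    have key := fun j hj hj' =>
      hblock (lo k) (hi k) j h2 (hlo_Q k) h3 hfree hj hj' (hlk.trans hkh) g
    rw [key k hl h1, key (k - 1) (by omega) (by omega), key (k + 1) (by omega) (by omega),
      Nat.cast_sub (by omega : 1 ≤ k)]
    push_cast
    ring

section FiniteDifference

variable {n : ℕ} {B : Matrix (Fin (n - 1)) (Fin n) ℝ}

theorem finiteDifference_mulVec
    (hB : ∀ i j, B i j = if j = fdIdx0 i then 1 else if j = fdIdx1 i then -1 else 0)
    (v : Fin n → ℝ) (i : Fin (n - 1)) :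
    (B *ᵥ v) i = v (fdIdx0 i) - v (fdIdx1 i) := by
  have hne : fdIdx1 i ≠ fdIdx0 i := by simp [fdIdx0, fdIdx1]
  have hterm : ∀ j, B i j * v j =
      (if j = fdIdx0 i then v j else 0) - (if j = fdIdx1 i then v j else 0) := by
    intro j
    rw [hB]
    by_cases h0 : j = fdIdx0 i
    · subst h0; simp [hne.symm]
    · by_cases h1 : j = fdIdx1 i <;> simp [h0, h1, hne]
  simp [mulVec, dotProduct, hterm, Finset.sum_sub_distrib]

theorem finiteDifference_transpose_mulVec
    (hB : ∀ i j, B i j = if j = fdIdx0 i then 1 else if j = fdIdx1 i then -1 else 0)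
    (f : ℕ → ℝ) (h0 : f 0 = 0) (hn : f n = 0) (k : Fin n) :
    (Bᵀ *ᵥ fun i : Fin (n - 1) => f (i + 1)) k = f (k + 1) - f k := by
  have hterm : ∀ i : Fin (n - 1), B i k * f (i + 1) =
      (if (i : ℕ) = k then f (k + 1) else 0) - (if (i : ℕ) + 1 = k then f k else 0) := by
    intro i
    rw [hB]
    simp only [fdIdx0, fdIdx1, Fin.ext_iff]
    rcases eq_or_ne (i : ℕ) k with h | h
    · simp [h]
    rcases eq_or_ne ((i : ℕ) + 1) k with h' | h'
    · simp [← h']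
    · simp [h, h', h.symm, h'.symm]
  simp only [mulVec, dotProduct, transpose_apply, hterm, Finset.sum_sub_distrib]
  have hk := k.isLt
  congr 1
  · by_cases h : (k : ℕ) + 1 = n
    · rw [h, hn]; simp
    · rw [Finset.sum_eq_single (⟨k, by omega⟩ : Fin (n - 1))]
      · simp
      · intro b _ hb
        exact if_neg fun h' => hb (Fin.ext h')
      · simp
  · by_cases h : (k : ℕ) = 0
    · rw [h, h0]; simp
    · rw [Finset.sum_eq_single (⟨k - 1, by omega⟩ : Fin (n - 1))]
      · exact if_pos (show (k : ℕ) - 1 + 1 = k by omega)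
      · intro b _ hb
        exact if_neg fun h' => hb (Fin.ext (show (b : ℕ) = k - 1 by omega))
      · simp

theorem finiteDifference_mul_transpose_mulVec
    (hB : ∀ i j, B i j = if j = fdIdx0 i then 1 else if j = fdIdx1 i then -1 else 0)
    (f : ℕ → ℝ) (h0 : f 0 = 0) (hn : f n = 0) (i : Fin (n - 1)) :
    ((B * Bᵀ) *ᵥ fun i : Fin (n - 1) => f (i + 1)) i = 2 * f (i + 1) - (f i + f (i + 2)) := by
  rw [← mulVec_mulVec, finiteDifference_mulVec hB,
    finiteDifference_transpose_mulVec hB f h0 hn, finiteDifference_transpose_mulVec hB f h0 hn]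
  simp only [fdIdx0, fdIdx1]
  ring

theorem finiteDifference_mul_transpose_posDef
    (hB : ∀ i j, B i j = if j = fdIdx0 i then 1 else if j = fdIdx1 i then -1 else 0) :
    (B * Bᵀ).PosDef := by
  rw [← conjTranspose_eq_transpose_of_trivial]
  refine PosDef.mul_conjTranspose_self B ?_
  change Function.Injective B.vecMulLinear
  refine (injective_iff_map_eq_zero _).2 fun w hw => ?_
  let f : ℕ → ℝ := fun k => if h : 1 ≤ k ∧ k < n then w ⟨k - 1, by omega⟩ else 0
  have hf : (fun i : Fin (n - 1) => f (i + 1)) = w := by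
    funext i
    have hi := i.isLt
    simp only [f]
    rw [dif_pos ⟨by omega, by omega⟩]
    simp
  have hstep : ∀ k < n, f (k + 1) = f k := by
    intro k hk
    have h := finiteDifference_transpose_mulVec hB f (by simp [f]) (by simp [f]) ⟨k, hk⟩
    rw [hf, mulVec_transpose] at h
    have h' : (w ᵥ* B) ⟨k, hk⟩ = 0 := congrFun hw _
    rw [h'] at h
    exact (sub_eq_zero.mp h.symm)
  have hzero : ∀ k ≤ n, f k = 0 := by
    intro k
    induction k with
    | zero => simp [f]
    | succ k ih => exact fun hk => (hstep k hk).trans (ih (by omega))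
  rw [← hf]
  funext i
  exact hzero _ (by have := i.isLt; omega)

end FiniteDifference

/-- Each row of the block is the negative of a convex combination of at most two indicators, at
positions `a` and `b` (in the numbering of `ℕ` starting from `1`). -/
theorem finiteDifference_schur_block_row {n : ℕ} {B : Matrix (Fin (n - 1)) (Fin n) ℝ}
    (hB : ∀ i j, B i j = if j = fdIdx0 i then 1 else if j = fdIdx1 i then -1 else 0)
    (S : Finset (Fin (n - 1))) (i : {i // i ∈ S}) :
    ∃ (a b : ℕ) (s : ℝ), 0 ≤ s ∧ s ≤ 1 ∧ ∀ j : {j // j ∈ Sᶜ},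
      (((B * Bᵀ).submatrix (fun i : {i // i ∈ S} => i.val) (fun j : {j // j ∈ S} => j.val))⁻¹ *
        (B * Bᵀ).submatrix (fun i : {i // i ∈ S} => i.val)
          (fun j : {j // j ∈ Sᶜ} => j.val)) i j =
      -((1 - s) * (if (j.val : ℕ) + 1 = a then 1 else 0) +
        s * (if (j.val : ℕ) + 1 = b then 1 else 0)) := by
  classical
  let Q : ℕ → Prop := fun k => ∀ i ∈ S, (i : ℕ) + 1 ≠ k
  have hQS : ∀ i ∈ S, ¬ Q (i + 1) := fun i hi h => h i hi rfl
  have hQSc : ∀ i ∉ S, Q (i + 1) := by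
    intro i hi m hm h
    exact hi ((Fin.ext (by omega) : m = i) ▸ hm)
  have hQ0 : Q 0 := fun m _ => Nat.succ_ne_zero _
  have hQn : Q n := fun m _ => by have := m.isLt; omega
  obtain ⟨lo, hi, s, hs⟩ := exists_harmonic_interpolation n Q hQ0 hQn
  have hlt : ∀ i : Fin (n - 1), (i : ℕ) + 1 < n := fun i => by have := i.isLt; omega
  refine ⟨lo (i.val + 1), hi (i.val + 1), s (i.val + 1), (hs _ (hlt i).le).1,
    (hs _ (hlt i).le).2.1, fun j => ?_⟩
  let g : ℕ → ℝ := fun k => if (j.val : ℕ) + 1 = k then 1 else 0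
  let f : ℕ → ℝ := fun k => (1 - s k) * g (lo k) + s k * g (hi k)
  have hfQ : ∀ k ≤ n, Q k → f k = g k := fun k hk hq => ((hs k hk).2.2 g).1 hq
  have hfS : ∀ k ≤ n, ¬ Q k → 2 * f k = f (k - 1) + f (k + 1) :=
    fun k hk hq => ((hs k hk).2.2 g).2 hq
  have hf0 : f 0 = 0 := by rw [hfQ 0 (Nat.zero_le n) hQ0]; simp [g]
  have hfn : f n = 0 := by
    rw [hfQ n le_rfl hQn]
    exact if_neg (hlt j).ne
  have hfSc : ∀ m : {m // m ∈ Sᶜ}, f (m.val + 1) = if m = j then 1 else 0 := by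
    intro m
    rw [hfQ _ (hlt m).le (hQSc _ (Finset.mem_compl.mp m.2))]
    simp only [g, Subtype.ext_iff, Fin.ext_iff]
    exact if_congr (by omega) rfl rfl
  set A := (B * Bᵀ).submatrix (fun i : {i // i ∈ S} => i.val) (fun j : {j // j ∈ S} => j.val)
    with hA
  set C := (B * Bᵀ).submatrix (fun i : {i // i ∈ S} => i.val) (fun j : {j // j ∈ Sᶜ} => j.val)
    with hC
  have hAunit : IsUnit A.det :=
    (Matrix.isUnit_iff_isUnit_det A).mp
      ((finiteDifference_mul_transpose_posDef hB).submatrix Subtype.val_injective).isUnit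
  have hsolve : A *ᵥ (fun m : {m // m ∈ S} => f (m.val + 1)) = -C.col j := by
    funext m
    have h := finiteDifference_mul_transpose_mulVec hB f hf0 hfn m.val
    have hh := hfS (m.val + 1) (hlt m).le (hQS _ m.2)
    rw [Nat.add_sub_cancel] at hh
    rw [hh, sub_self] at h
    simp only [mulVec, dotProduct] at h
    rw [← Finset.sum_add_sum_compl S, ← Finset.sum_coe_sort S, ← Finset.sum_coe_sort Sᶜ] at h
    simp only [hfSc, mul_ite, mul_one, mul_zero, Finset.sum_ite_eq',
      Finset.mem_univ, if_true] at h
    exact eq_neg_of_add_eq_zero_left h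
  have hcol : (A⁻¹ * C).col j = -fun m : {m // m ∈ S} => f (m.val + 1) := by
    have h : A⁻¹ *ᵥ C.col j = -fun m : {m // m ∈ S} => f (m.val + 1) := by
      rw [← neg_neg (C.col j), ← hsolve, mulVec_neg, mulVec_mulVec, nonsing_inv_mul A hAunit,
        one_mulVec]
    exact h
  exact congrFun hcol i

/-- Let `S = {i : x_i = x_{i+1}}` be nonempty with complement `Sᶜ`, and let
`M = ((B Bᵀ)_{S,S})⁻¹ (B Bᵀ)_{S,Sᶜ}`. Then every entry of `M` lies in `[−1, 0]`, every row
of `M` has at most two nonzero entries, and every row sum of `M` lies in `[−1, 0]`;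
consequently, for every `u` with `‖u‖_∞ ≤ 1`, one has `‖M u‖_∞ ≤ 1`. -/
theorem BBt_schur_block_bounds (n : ℕ) (hn : 2 ≤ n)
    (B : Matrix (Fin (n - 1)) (Fin n) ℝ)
    (hB : ∀ (i : Fin (n - 1)) (j : Fin n),
      B i j = if j = fdIdx0 i then 1 else if j = fdIdx1 i then -1 else 0)
    (x : Fin n → ℝ) (hx : x ≠ 0)
    (S : Finset (Fin (n - 1)))
    (hS : ∀ i : Fin (n - 1), i ∈ S ↔ x (fdIdx0 i) = x (fdIdx1 i))
    (hSne : S.Nonempty)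
    (M : Matrix {i // i ∈ S} {j // j ∈ Sᶜ} ℝ)
    (hM : M =
      ((B * Bᵀ).submatrix (fun i : {i // i ∈ S} => i.val) (fun j : {j // j ∈ S} => j.val))⁻¹ *
        (B * Bᵀ).submatrix (fun i : {i // i ∈ S} => i.val) (fun j : {j // j ∈ Sᶜ} => j.val)) :
    (∀ (i : {i // i ∈ S}) (j : {j // j ∈ Sᶜ}), M i j ∈ Set.Icc (-1 : ℝ) 0) ∧
    (∀ i : {i // i ∈ S}, (Finset.univ.filter (fun j : {j // j ∈ Sᶜ} => M i j ≠ 0)).card ≤ 2) ∧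
    (∀ i : {i // i ∈ S}, (∑ j : {j // j ∈ Sᶜ}, M i j) ∈ Set.Icc (-1 : ℝ) 0) ∧
    (∀ u : {j // j ∈ Sᶜ} → ℝ, (∀ j, |u j| ≤ 1) → ∀ i, |M.mulVec u i| ≤ 1) := by
  have hrow : ∀ i : {i // i ∈ S}, ∃ (a b : ℕ) (s : ℝ), 0 ≤ s ∧ s ≤ 1 ∧ ∀ j : {j // j ∈ Sᶜ},
      M i j = -((1 - s) * (if (j.val : ℕ) + 1 = a then 1 else 0) +
        s * (if (j.val : ℕ) + 1 = b then 1 else 0)) := by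
    subst hM
    exact finiteDifference_schur_block_row hB S
  have hentry : ∀ (i : {i // i ∈ S}) (j : {j // j ∈ Sᶜ}), M i j ∈ Set.Icc (-1 : ℝ) 0 := by
    intro i j
    obtain ⟨a, b, s, h0, h1, h⟩ := hrow i
    rw [h, Set.mem_Icc]
    split_ifs <;> constructor <;> linarith
  have hind : ∀ a : ℕ, ∑ j : {j // j ∈ Sᶜ}, (if (j.val : ℕ) + 1 = a then (1 : ℝ) else 0) ≤ 1 := by
    intro a
    rw [Finset.sum_boole]
    exact_mod_cast Finset.card_le_one.2 fun j hj k hk => by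
      simp only [Finset.mem_filter, Finset.mem_univ, true_and] at hj hk
      exact Subtype.ext (Fin.ext (by omega))
  have hsum : ∀ i : {i // i ∈ S}, (∑ j : {j // j ∈ Sᶜ}, M i j) ∈ Set.Icc (-1 : ℝ) 0 := by
    intro i
    refine ⟨?_, Finset.sum_nonpos fun j _ => (hentry i j).2⟩
    obtain ⟨a, b, s, h0, h1, h⟩ := hrow i
    simp only [h, Finset.sum_neg_distrib, Finset.sum_add_distrib, ← Finset.mul_sum]
    nlinarith [mul_le_mul_of_nonneg_left (hind a) (sub_nonneg.mpr h1),
      mul_le_mul_of_nonneg_left (hind b) h0]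
  refine ⟨hentry, fun i => ?_, hsum, fun u hu i => ?_⟩
  · obtain ⟨a, b, s, -, -, h⟩ := hrow i
    refine (Finset.card_le_card_of_injOn (t := {a, b}) (fun j => (j.val : ℕ) + 1) ?_ ?_).trans
      Finset.card_le_two
    · intro j hj
      simp only [Finset.coe_filter, Finset.mem_univ, true_and, Set.mem_ofPred_eq] at hj
      by_contra hcon
      simp only [Finset.coe_insert, Finset.coe_singleton, Set.mem_insert_iff,
        Set.mem_singleton_iff, not_or] at hcon
      exact hj (by rw [h, if_neg hcon.1, if_neg hcon.2]; ring)
    · intro j _ k _ hjk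
      exact Subtype.ext (Fin.ext (Nat.succ_injective hjk))
  · calc |M.mulVec u i| ≤ ∑ j, |M i j * u j| := Finset.abs_sum_le_sum_abs _ _
      _ ≤ ∑ j, -M i j := by
        refine Finset.sum_le_sum fun j _ => ?_
        rw [abs_mul, abs_of_nonpos (hentry i j).2]
        exact mul_le_of_le_one_right (neg_nonneg.mpr (hentry i j).2) (hu j)
      _ ≤ 1 := by
        rw [Finset.sum_neg_distrib]
        linarith [(hsum i).1]
end

section
/- Let n ≥ 2 and let x ∈ ℝⁿ be nonzero, and let f(x) = ‖Bx‖₁ be the total variation seminorm with subdifferential ∂f(x). Then D(cone(∂f(x))) ≤ inf_{λ ≥ 0} D(λ ∂f(x)) ≤ D(cone(∂f(x))) + 6, where D(C) = E[dist(g, C)²] for a standard Gaussian vector g on ℝⁿ. -/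
open Matrix MeasureTheory
open scoped Pointwise

/-- The standard Gaussian measure on `ℝⁿ`: the product of `n` standard Gaussians on `ℝ`. -/
noncomputable def stdGauss (n : ℕ) : Measure (Fin n → ℝ) :=
  Measure.pi fun _ => ProbabilityTheory.gaussianReal 0 1

/-- Euclidean (`ℓ₂`) distance from a point `g ∈ ℝⁿ` to a set `C ⊆ ℝⁿ`:
`dist(g, C) = inf_{u ∈ C} ‖g − u‖₂`. -/
noncomputable def euclDist {n : ℕ} (g : Fin n → ℝ) (C : Set (Fin n → ℝ)) : ℝ :=
  ⨅ u : C, Real.sqrt (∑ i, (g i - (u : Fin n → ℝ) i) ^ 2)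

/-- `D(C) = E[dist(g, C)²]` where `g ∼ N(0, Iₙ)` is a standard Gaussian vector on `ℝⁿ`. -/
noncomputable def gaussD (n : ℕ) (C : Set (Fin n → ℝ)) : ℝ :=
  ∫ g, (euclDist g C) ^ 2 ∂(stdGauss n)

/-- `cone(C) = {λu : λ ≥ 0, u ∈ C}`. -/
def coneOf {n : ℕ} (C : Set (Fin n → ℝ)) : Set (Fin n → ℝ) :=
  {y | ∃ (l : ℝ) (u : Fin n → ℝ), 0 ≤ l ∧ u ∈ C ∧ y = l • u}

open ProbabilityTheory Filter Topology

/-- Finite powers of measures on `ℝ` preserve absolute continuity. -/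
theorem pi_fin_absolutelyContinuous {μ ν : Measure ℝ} [SigmaFinite μ] [SigmaFinite ν]
    (h : μ ≪ ν) (n : ℕ) :
    Measure.pi (fun _ : Fin n => μ) ≪ Measure.pi (fun _ : Fin n => ν) := by
  induction n with
  | zero => rw [Measure.pi_of_empty, Measure.pi_of_empty]
  | succ n ih =>
    have h1 := (measurePreserving_piFinSuccAbove (fun _ : Fin (n + 1) => μ) 0).symm
    have h2 := (measurePreserving_piFinSuccAbove (fun _ : Fin (n + 1) => ν) 0).symm
    rw [← h1.map_eq, ← h2.map_eq]
    exact (h.prod ih).map h1.measurable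

theorem stdGaussian_absolutelyContinuous (n : ℕ) :
    stdGaussian (EuclideanSpace ℝ (Fin n)) ≪ volume := by
  rw [← map_pi_eq_stdGaussian, ← (PiLp.volume_preserving_toLp (Fin n)).map_eq]
  exact (pi_fin_absolutelyContinuous (gaussianReal_absolutelyContinuous 0 one_ne_zero) n).map
    (PiLp.volume_preserving_toLp (Fin n)).measurable

section Poincare

variable {n : ℕ} {f : EuclideanSpace ℝ (Fin n) → ℝ}

local notation "𝕍" => EuclideanSpace ℝ (Fin n)
local notation "γ" => stdGaussian (EuclideanSpace ℝ (Fin n))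

theorem integrable_norm_add_norm_sq :
    Integrable (fun p : 𝕍 × 𝕍 => (‖p.1‖ + ‖p.2‖) ^ 2) ((γ).prod γ) := by
  have h : MemLp (id : 𝕍 → 𝕍) 2 γ := IsGaussian.memLp_two_id
  have h1 : MemLp (fun p : 𝕍 × 𝕍 => ‖p.1‖ + ‖p.2‖) 2 ((γ).prod γ) :=
    (h.comp_measurePreserving measurePreserving_fst).norm.add
      (h.comp_measurePreserving measurePreserving_snd).norm
  exact h1.integrable_sq

theorem integral_clm_sq_le_one (L : StrongDual ℝ 𝕍) (hL : ‖L‖ ≤ 1) : ∫ y, L y ^ 2 ∂γ ≤ 1 := by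
  have h := variance_dual_stdGaussian L
  rw [variance_of_integral_eq_zero L.continuous.aemeasurable
    (integral_strongDual_stdGaussian L)] at h
  rw [h]
  exact pow_le_one₀ (norm_nonneg _) hL

/-- The increment of `f` along a rotation by angle `θ` mixing two independent copies. -/
noncomputable def rotIncr (f : EuclideanSpace ℝ (Fin n) → ℝ) (θ : ℝ)
    (p : EuclideanSpace ℝ (Fin n) × EuclideanSpace ℝ (Fin n)) : ℝ :=
  f (Real.cos θ • p.1 + Real.sin θ • p.2) - f p.1

theorem abs_rotIncr_le (hf : LipschitzWith 1 f) {θ : ℝ} (hθ : 0 ≤ θ) (p : 𝕍 × 𝕍) :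
    |rotIncr f θ p| ≤ θ * (‖p.1‖ + ‖p.2‖) := by
  have h := hf.dist_le_mul (Real.cos θ • p.1 + Real.sin θ • p.2) p.1
  rw [Real.dist_eq, NNReal.coe_one, one_mul, dist_eq_norm] at h
  refine h.trans ?_
  have e : Real.cos θ • p.1 + Real.sin θ • p.2 - p.1 =
      (Real.cos θ - 1) • p.1 + Real.sin θ • p.2 := by module
  rw [e]
  refine (norm_add_le _ _).trans ?_
  rw [norm_smul, norm_smul, Real.norm_eq_abs, Real.norm_eq_abs]
  have h1 : |Real.cos θ - 1| ≤ θ := by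
    have := Real.abs_cos_sub_cos_le θ 0
    simpa [abs_of_nonneg hθ] using this
  have h2 : |Real.sin θ| ≤ θ := by
    have := Real.abs_sin_le_abs (x := θ)
    simpa [abs_of_nonneg hθ] using this
  rw [mul_add]
  gcongr

theorem continuous_rotIncr (hf : LipschitzWith 1 f) (θ : ℝ) : Continuous (rotIncr f θ) := by
  have := hf.continuous
  unfold rotIncr
  fun_prop

theorem integrable_rotIncr_sq (hf : LipschitzWith 1 f) {θ : ℝ} (hθ : 0 ≤ θ) :
    Integrable (fun p => rotIncr f θ p ^ 2) ((γ).prod γ) := by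
  refine ((integrable_norm_add_norm_sq (n := n)).const_mul (θ ^ 2)).mono'
    ((continuous_rotIncr hf θ).pow 2).aestronglyMeasurable (ae_of_all _ fun p => ?_)
  rw [Real.norm_eq_abs, abs_pow, ← mul_pow]
  exact pow_le_pow_left₀ (abs_nonneg _) (abs_rotIncr_le hf hθ p) 2

theorem measurePreserving_rotation (θ : ℝ) :
    MeasurePreserving (ContinuousLinearMap.rotation (E := 𝕍) θ) ((γ).prod γ) ((γ).prod γ) :=
  ⟨by fun_prop, IsGaussian.map_rotation_eq_self integral_id_stdGaussian θ⟩

theorem rotIncr_comp_rotation (θ δ : ℝ) (p : 𝕍 × 𝕍) :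
    rotIncr f δ (ContinuousLinearMap.rotation θ p) = rotIncr f (θ + δ) p - rotIncr f θ p := by
  simp only [rotIncr, ContinuousLinearMap.rotation_apply, Real.cos_add, Real.sin_add]
  have e : Real.cos δ • (Real.cos θ • p.1 + Real.sin θ • p.2) +
      Real.sin δ • (-Real.sin θ • p.1 + Real.cos θ • p.2) =
      (Real.cos θ * Real.cos δ - Real.sin θ * Real.sin δ) • p.1 +
      (Real.sin θ * Real.cos δ + Real.cos θ * Real.sin δ) • p.2 := by module
  rw [e]; ring

theorem integral_rotIncr_nat_mul_sq_le (hf : LipschitzWith 1 f) (N : ℕ) {δ : ℝ} (hδ : 0 ≤ δ) :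
    ∫ p, rotIncr f (N * δ) p ^ 2 ∂((γ).prod γ) ≤
      ∫ p, (N * rotIncr f δ p) ^ 2 ∂((γ).prod γ) := by
  have hsum : ∀ p : 𝕍 × 𝕍, rotIncr f (N * δ) p =
      ∑ k ∈ Finset.range N, rotIncr f δ (ContinuousLinearMap.rotation (k * δ) p) := by
    intro p
    have : ∀ k : ℕ, rotIncr f δ (ContinuousLinearMap.rotation (k * δ) p) =
        rotIncr f ((k + 1 : ℕ) * δ) p - rotIncr f (k * δ) p := fun k => by
      rw [rotIncr_comp_rotation]; push_cast; ring_nf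
    simp_rw [this]
    rw [Finset.sum_range_sub (fun k : ℕ => rotIncr f (k * δ) p)]
    simp [rotIncr]
  have hint : ∀ k : ℕ, Integrable
      (fun p : 𝕍 × 𝕍 => rotIncr f δ (ContinuousLinearMap.rotation (k * δ) p) ^ 2)
      ((γ).prod γ) := fun k =>
    (measurePreserving_rotation (k * δ)).integrable_comp_of_integrable
      (integrable_rotIncr_sq hf hδ)
  have heq : ∀ k : ℕ,
      ∫ p : 𝕍 × 𝕍, rotIncr f δ (ContinuousLinearMap.rotation (k * δ) p) ^ 2 ∂((γ).prod γ) =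
      ∫ p, rotIncr f δ p ^ 2 ∂((γ).prod γ) := fun k => by
    have hm := measurePreserving_rotation (n := n) (k * δ)
    have h := integral_map (f := fun p => rotIncr f δ p ^ 2) hm.aemeasurable
      ((continuous_rotIncr hf δ).pow 2).aestronglyMeasurable
    rw [hm.map_eq] at h
    exact h.symm
  calc ∫ p, rotIncr f (N * δ) p ^ 2 ∂((γ).prod γ)
      ≤ ∫ p : 𝕍 × 𝕍, N * ∑ k ∈ Finset.range N,
          rotIncr f δ (ContinuousLinearMap.rotation (k * δ) p) ^ 2 ∂((γ).prod γ) := by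
        refine integral_mono (integrable_rotIncr_sq hf (by positivity))
          ((integrable_finsetSum _ fun k _ => hint k).const_mul _) fun p => ?_
        simp only
        rw [hsum]
        simpa using sq_sum_le_card_mul_sum_sq (s := Finset.range N)
          (f := fun k : ℕ => rotIncr f δ (ContinuousLinearMap.rotation (k * δ) p))
    _ = ∫ p, (N * rotIncr f δ p) ^ 2 ∂((γ).prod γ) := by
        rw [integral_const_mul, integral_finsetSum _ fun k _ => hint k]
        simp_rw [heq, mul_pow, integral_const_mul]
        simp
        ring

theorem tendsto_nat_mul_rotIncr {x : 𝕍} (hx : DifferentiableAt ℝ f x) (y : 𝕍) :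
    Tendsto (fun N : ℕ => N * rotIncr f (Real.pi / 2 / N) (x, y)) atTop
      (𝓝 (Real.pi / 2 * fderiv ℝ f x y)) := by
  have hc : HasDerivAt (fun θ : ℝ => Real.cos θ • x + Real.sin θ • y) y 0 := by
    have := ((Real.hasDerivAt_cos 0).smul_const x).add ((Real.hasDerivAt_sin 0).smul_const y)
    simpa using! this
  have hx' : HasFDerivAt f (fderiv ℝ f x) (Real.cos 0 • x + Real.sin 0 • y) := by
    simpa using hx.hasFDerivAt
  have hd := hx'.comp_hasDerivAt (0 : ℝ) hc
  have hs := hd.tendsto_slope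
  have hseq : Tendsto (fun N : ℕ => Real.pi / 2 / (N : ℝ)) atTop (𝓝[≠] 0) := by
    refine tendsto_nhdsWithin_iff.2 ⟨tendsto_const_div_atTop_nhds_zero_nat _, ?_⟩
    filter_upwards [eventually_gt_atTop 0] with N hN
    have : (0 : ℝ) < N := by exact_mod_cast hN
    have := Real.pi_pos
    simp only [Set.mem_compl_iff, Set.mem_singleton_iff]
    positivity
  refine ((hs.comp hseq).const_mul (Real.pi / 2)).congr' ?_
  filter_upwards [eventually_gt_atTop 0] with N hN
  have : (0 : ℝ) < N := by exact_mod_cast hN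
  have := Real.pi_pos
  simp only [Function.comp, slope_def_field, rotIncr]
  simp
  field_simp

/-- A Poincaré-type inequality for `1`-Lipschitz functions of a standard Gaussian vector. -/
theorem integral_sub_sq_le_of_lipschitz (hf : LipschitzWith 1 f) :
    ∫ p : 𝕍 × 𝕍, (f p.2 - f p.1) ^ 2 ∂((γ).prod γ) ≤ (Real.pi / 2) ^ 2 := by
  have hpi := Real.pi_pos
  have hfd : ∀ x, ‖fderiv ℝ f x‖ ≤ 1 := fun x => by
    simpa using norm_fderiv_le_of_lipschitz ℝ hf (x₀ := x)
  have hae : ∀ᵐ p : 𝕍 × 𝕍 ∂((γ).prod γ), DifferentiableAt ℝ f p.1 :=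
    measurePreserving_fst.quasiMeasurePreserving.ae
      ((stdGaussian_absolutelyContinuous n).ae_le hf.ae_differentiableAt)
  have hlim : Tendsto
      (fun N : ℕ => ∫ p, (N * rotIncr f (Real.pi / 2 / N) p) ^ 2 ∂((γ).prod γ)) atTop
      (𝓝 (∫ p, (Real.pi / 2 * fderiv ℝ f p.1 p.2) ^ 2 ∂((γ).prod γ))) := by
    refine tendsto_integral_of_dominated_convergence
      (fun p => (Real.pi / 2) ^ 2 * (‖p.1‖ + ‖p.2‖) ^ 2)
      (fun N => (((continuous_rotIncr hf _).const_mul _).pow 2).aestronglyMeasurable)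
      ((integrable_norm_add_norm_sq (n := n)).const_mul _)
      (fun N => ae_of_all _ fun p => ?_) ?_
    · rw [Real.norm_eq_abs, abs_pow, ← mul_pow]
      refine pow_le_pow_left₀ (abs_nonneg _) ?_ 2
      rw [abs_mul, Nat.abs_cast]
      rcases Nat.eq_zero_or_pos N with rfl | hN
      · simp; positivity
      have hN' : (0 : ℝ) < N := by exact_mod_cast hN
      have := abs_rotIncr_le hf (θ := Real.pi / 2 / N) (by positivity) p
      calc N * |rotIncr f (Real.pi / 2 / N) p|
          ≤ N * (Real.pi / 2 / N * (‖p.1‖ + ‖p.2‖)) := by gcongr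
        _ = _ := by field_simp
    · filter_upwards [hae] with p hp
      exact (tendsto_nat_mul_rotIncr hp p.2).pow 2
  have hbound : ∫ p : 𝕍 × 𝕍, (Real.pi / 2 * fderiv ℝ f p.1 p.2) ^ 2 ∂((γ).prod γ) ≤
      (Real.pi / 2) ^ 2 := by
    simp_rw [mul_pow]
    rw [integral_const_mul]
    have hm : Measurable (fun p : 𝕍 × 𝕍 => fderiv ℝ f p.1 p.2 ^ 2) := by
      have h1 := measurable_fderiv ℝ f
      have h2 : Measurable (fun p : 𝕍 × 𝕍 => fderiv ℝ f p.1 p.2) := by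
        exact (isBoundedBilinearMap_apply (𝕜 := ℝ) (E := 𝕍) (F := ℝ)).continuous.measurable.comp
          ((h1.comp measurable_fst).prodMk measurable_snd)
      exact h2.pow_const 2
    have hi : Integrable (fun p : 𝕍 × 𝕍 => fderiv ℝ f p.1 p.2 ^ 2) ((γ).prod γ) := by
      refine (integrable_norm_add_norm_sq (n := n)).mono' hm.aestronglyMeasurable
        (ae_of_all _ fun p => ?_)
      rw [norm_pow]
      refine pow_le_pow_left₀ (norm_nonneg _) ?_ 2
      refine ((fderiv ℝ f p.1).le_of_opNorm_le (hfd _) p.2).trans ?_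
      linarith [norm_nonneg p.1]
    rw [integral_prod _ hi]
    have : ∫ x : 𝕍, ∫ y : 𝕍, fderiv ℝ f x y ^ 2 ∂γ ∂γ ≤ ∫ _ : 𝕍, (1 : ℝ) ∂γ :=
      integral_mono hi.integral_prod_left (integrable_const _)
        fun x => integral_clm_sq_le_one _ (hfd x)
    simp only [integral_const, probReal_univ, smul_eq_mul, mul_one] at this
    have h2 : 0 ≤ (Real.pi / 2) ^ 2 := by positivity
    nlinarith
  refine le_trans (ge_of_tendsto hlim ?_) hbound
  filter_upwards [eventually_gt_atTop 0] with N hN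
  have hN' : (0 : ℝ) < N := by exact_mod_cast hN
  have h := integral_rotIncr_nat_mul_sq_le hf N (δ := Real.pi / 2 / N) (by positivity)
  rw [mul_div_cancel₀ _ hN'.ne'] at h
  simpa [rotIncr] using h

theorem integrable_sq_of_lipschitz (hf : LipschitzWith 1 f) :
    Integrable (fun x => f x ^ 2) γ := by
  have h : MemLp (id : 𝕍 → 𝕍) 2 γ := IsGaussian.memLp_two_id
  have h1 : MemLp (fun x : 𝕍 => ‖x‖ + |f 0|) 2 γ := h.norm.add (memLp_const _)
  refine h1.integrable_sq.mono' (hf.continuous.pow 2).aestronglyMeasurable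
    (ae_of_all _ fun x => ?_)
  rw [Real.norm_eq_abs, abs_pow]
  refine pow_le_pow_left₀ (abs_nonneg _) ?_ 2
  have := hf.dist_le_mul x 0
  simp only [Real.dist_eq, NNReal.coe_one, one_mul, dist_zero_right] at this
  have h3 := abs_sub_abs_le_abs_sub (f x) (f 0)
  linarith

/-- A set of Gaussian measure at least `1/2` is close to a Gaussian vector in mean square. -/
theorem integral_infDist_sq_le {A : Set (EuclideanSpace ℝ (Fin n))} (hA : MeasurableSet A)
    (hA2 : 1 / 2 ≤ (γ).real A) :
    ∫ x, Metric.infDist x A ^ 2 ∂γ ≤ (Real.pi / 2) ^ 2 := by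
  set d : 𝕍 → ℝ := fun x => Metric.infDist x A
  have hd : LipschitzWith 1 d := Metric.lipschitz_infDist_pt A
  have hdi : Integrable (fun x => d x ^ 2) γ := integrable_sq_of_lipschitz hd
  have hind : Integrable (A.indicator (fun _ => (1 : ℝ))) γ :=
    (integrable_const 1).indicator hA
  have hz : ∀ x ∈ A, d x = 0 := fun x hx => Metric.infDist_zero_of_mem hx
  have hcomp : ∫ p : 𝕍 × 𝕍, (d p.1 ^ 2 * A.indicator (fun _ => 1) p.2 +
      A.indicator (fun _ => 1) p.1 * d p.2 ^ 2) ∂((γ).prod γ) ≤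
      ∫ p : 𝕍 × 𝕍, (d p.2 - d p.1) ^ 2 ∂((γ).prod γ) := by
    refine integral_mono ((hdi.mul_prod hind).add (hind.mul_prod hdi)) ?_ fun p => ?_
    · have := integrable_rotIncr_sq hd (θ := Real.pi / 2) (by positivity)
      simpa [rotIncr] using this
    · simp only
      by_cases h1 : p.1 ∈ A <;> by_cases h2 : p.2 ∈ A <;>
        simp [h1, h2, hz, sq_nonneg]
  rw [integral_add (hdi.mul_prod hind) (hind.mul_prod hdi), integral_prod_mul (fun x => d x ^ 2),
    integral_prod_mul _ (fun x => d x ^ 2), integral_indicator_const _ hA] at hcomp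
  have h0 : 0 ≤ ∫ x, d x ^ 2 ∂γ := integral_nonneg fun x => sq_nonneg _
  have := integral_sub_sq_le_of_lipschitz hd
  simp only [smul_eq_mul, mul_one] at hcomp
  nlinarith

end Poincare

section ConeProjection

variable {H : Type*} [NormedAddCommGroup H] [InnerProductSpace ℝ H]

/-- `p` is the metric projection of `g` onto the convex cone `K` (Moreau's characterization). -/
def IsConeProj (K : Set H) (g p : H) : Prop :=
  p ∈ K ∧ inner ℝ (g - p) p = 0 ∧ ∀ k ∈ K, inner ℝ (g - p) k ≤ 0

theorem exists_isConeProj [CompleteSpace H] {K : Set H} (hne : K.Nonempty) (hcl : IsClosed K)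
    (hconv : Convex ℝ K) (hcone : ∀ c : ℝ, 0 ≤ c → ∀ y ∈ K, c • y ∈ K) (g : H) :
    ∃ p, IsConeProj K g p := by
  obtain ⟨p, hp, hmin⟩ := exists_norm_eq_iInf_of_complete_convex hne hcl.isComplete hconv g
  have h := (norm_eq_iInf_iff_real_inner_le_zero hconv hp).1 hmin
  have h0 := h _ (hcone 0 le_rfl p hp)
  have h2 := h _ (hcone 2 (by norm_num) p hp)
  have e2 : (2 : ℝ) • p - p = p := by module
  rw [zero_smul, zero_sub, inner_neg_right] at h0
  rw [e2] at h2
  have hz : inner ℝ (g - p) p = 0 := by linarith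
  refine ⟨p, hp, hz, fun k hk => ?_⟩
  have := h k hk
  rwa [inner_sub_right, hz, sub_zero] at this

theorem IsConeProj.norm_sub_le {K : Set H} {g g' p p' : H} (h : IsConeProj K g p)
    (h' : IsConeProj K g' p') : ‖p - p'‖ ≤ ‖g - g'‖ := by
  have h1 := h.2.2 p' h'.1
  have h2 := h'.2.2 p h.1
  have h3 := h.2.1
  have h4 := h'.2.1
  have key : ‖p - p'‖ ^ 2 ≤ inner ℝ (g - g') (p - p') := by
    rw [← real_inner_self_eq_norm_sq]
    simp only [inner_sub_left, inner_sub_right] at *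
    linarith
  have hcs := real_inner_le_norm (g - g') (p - p')
  by_contra! hlt
  have := norm_nonneg (g - g')
  nlinarith

theorem IsConeProj.unique {K : Set H} {g p p' : H} (h : IsConeProj K g p)
    (h' : IsConeProj K g p') : p = p' := by
  have := h.norm_sub_le h'
  rwa [sub_self, norm_zero, norm_le_zero_iff, sub_eq_zero] at this

theorem IsConeProj.add_smul {K : Set H} {g p : H} (h : IsConeProj K g p) {s : ℝ} (hs : -1 ≤ s) :
    IsConeProj K (g + s • (g - p)) p := by
  have e : g + s • (g - p) - p = (1 + s) • (g - p) := by module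
  refine ⟨h.1, ?_, fun k hk => ?_⟩
  · rw [e, real_inner_smul_left, h.2.1, mul_zero]
  · rw [e, real_inner_smul_left]
    exact mul_nonpos_of_nonneg_of_nonpos (by linarith) (h.2.2 k hk)

theorem eq_zero_of_forall_two_mul_le_sq_mul {a b : ℝ} (hb : 0 ≤ b)
    (h : ∀ s : ℝ, |s| ≤ 1 → 2 * (s * a) ≤ s ^ 2 * b) : a = 0 := by
  by_contra ha
  have ha' : 0 < |a| := abs_pos.2 ha
  have hT : 0 < |a| + b := by positivity
  have h1 : |a / (|a| + b)| ≤ 1 := by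
    rw [abs_div, abs_of_pos hT, div_le_one hT]; linarith
  have h2 := h _ h1
  have h3 : 0 < a ^ 2 := by positivity
  have h4 : 2 * (a / (|a| + b) * a) = 2 * a ^ 2 / (|a| + b) := by ring
  have h5 : (a / (|a| + b)) ^ 2 * b = a ^ 2 * (b / (|a| + b)) / (|a| + b) := by
    field_simp
  rw [h4, h5, div_le_div_iff_of_pos_right hT] at h2
  have h6 : b / (|a| + b) ≤ 1 := by rw [div_le_one hT]; linarith
  nlinarith

/-- Slicing a cone by the value of a linear functional costs at most the squared distance to the
corresponding level set of the functional composed with the projection. -/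
theorem infDist_slice_sq_le [FiniteDimensional ℝ H] {K : Set H} {P : H → H}
    (hP : ∀ g, IsConeProj K g (P g)) (hPc : Continuous P) (x : H) {m : ℝ}
    (hL : {g | inner ℝ (P g) x = m}.Nonempty) (g : H) :
    Metric.infDist g {k | k ∈ K ∧ inner ℝ k x = m} ^ 2 ≤
      Metric.infDist g K ^ 2 + Metric.infDist g {g | inner ℝ (P g) x = m} ^ 2 := by
  have hclosed : IsClosed {g | inner ℝ (P g) x = m} := isClosed_eq (by fun_prop) continuous_const
  have := FiniteDimensional.proper ℝ H
  obtain ⟨g', hg', hdist⟩ := hclosed.exists_infDist_eq_dist hL g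
  have horth : inner ℝ (g - g') (g' - P g') = 0 := by
    refine eq_zero_of_forall_two_mul_le_sq_mul (sq_nonneg ‖g' - P g'‖) fun s hs => ?_
    have hmem : g' + s • (g' - P g') ∈ {g | inner ℝ (P g) x = m} := by
      have := (hP (g' + s • (g' - P g'))).unique ((hP g').add_smul (neg_le_of_abs_le hs))
      rw [Set.mem_ofPred_eq, this]
      exact hg'
    have hle := Metric.infDist_le_dist_of_mem (x := g) hmem
    rw [hdist, dist_eq_norm, dist_eq_norm, ← sub_sub] at hle
    have hsq := pow_le_pow_left₀ (norm_nonneg _) hle 2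
    rw [norm_sub_sq_real (g - g'), real_inner_smul_right, norm_smul, mul_pow, Real.norm_eq_abs,
      sq_abs] at hsq
    linarith
  have h1 : Metric.infDist g {k | k ∈ K ∧ inner ℝ k x = m} ≤ ‖g - P g'‖ := by
    rw [← dist_eq_norm]
    exact Metric.infDist_le_dist_of_mem ⟨(hP g').1, hg'⟩
  have h2 : ‖g - P g'‖ ^ 2 = ‖g - g'‖ ^ 2 + ‖g' - P g'‖ ^ 2 := by
    have e : g - P g' = (g - g') + (g' - P g') := by abel
    rw [e, norm_add_sq_real, horth]; ring
  have h3 : ‖g' - P g'‖ ≤ Metric.infDist g K := by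
    refine (Metric.le_infDist ⟨_, (hP g').1⟩).2 fun k hk => ?_
    have ha := (hP g').2.2 k hk
    have hb := (hP g').2.1
    have hc : ‖g' - P g'‖ ^ 2 ≤ inner ℝ (g - k) (g' - P g') := by
      have e : g - k = (g - g') + (g' - P g') + P g' - k := by abel
      rw [e, inner_sub_left, inner_add_left, inner_add_left, horth, real_inner_self_eq_norm_sq,
        real_inner_comm _ (P g'), real_inner_comm _ k, hb]
      linarith
    have hd := real_inner_le_norm (g - k) (g' - P g')
    rw [dist_eq_norm]
    by_contra! hlt
    have := norm_nonneg (g - k)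
    nlinarith
  rw [hdist, dist_eq_norm]
  have h4 := pow_le_pow_left₀ Metric.infDist_nonneg h1 2
  have h5 := pow_le_pow_left₀ (norm_nonneg _) h3 2
  linarith

theorem exists_level_dist_le {h : H → ℝ} (hh : Continuous h) {g a : H} {m : ℝ}
    (hm : m ∈ Set.uIcc (h g) (h a)) : ∃ z, h z = m ∧ dist g z ≤ dist g a := by
  have hc : Continuous fun t : ℝ => h (AffineMap.lineMap g a t) :=
    hh.comp AffineMap.lineMap_continuous
  have := intermediate_value_uIcc (a := (0 : ℝ)) (b := 1) hc.continuousOn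
  obtain ⟨t, ht, hz⟩ := this (by simpa using hm)
  rw [Set.uIcc_of_le zero_le_one] at ht
  refine ⟨_, hz, ?_⟩
  rw [dist_left_lineMap, Real.norm_eq_abs, abs_of_nonneg ht.1]
  exact mul_le_of_le_one_left dist_nonneg ht.2

theorem infDist_level_sq_le {h : H → ℝ} (hh : Continuous h) {m : ℝ} (h1 : {g | h g ≤ m}.Nonempty)
    (h2 : {g | m ≤ h g}.Nonempty) (g : H) :
    Metric.infDist g {g | h g = m} ^ 2 ≤
      Metric.infDist g {g | h g ≤ m} ^ 2 + Metric.infDist g {g | m ≤ h g} ^ 2 := by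
  have key : ∀ A : Set H, A.Nonempty → (∀ a ∈ A, m ∈ Set.uIcc (h g) (h a)) →
      Metric.infDist g {g | h g = m} ^ 2 ≤ Metric.infDist g A ^ 2 := fun A hA hA' => by
    refine pow_le_pow_left₀ Metric.infDist_nonneg ((Metric.le_infDist hA).2 fun a ha => ?_) 2
    obtain ⟨z, hz, hd⟩ := exists_level_dist_le hh (hA' a ha)
    exact (Metric.infDist_le_dist_of_mem (s := {g | h g = m}) hz).trans hd
  rcases le_total m (h g) with hg | hg
  · have := key _ h1 fun a ha => Set.mem_uIcc.2 (Or.inr ⟨ha, hg⟩)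
    nlinarith [sq_nonneg (Metric.infDist g {g | m ≤ h g})]
  · have := key _ h2 fun a ha => Set.mem_uIcc.2 (Or.inl ⟨hg, ha⟩)
    nlinarith [sq_nonneg (Metric.infDist g {g | h g ≤ m})]

end ConeProjection

/-- Every probability measure on the line has a median. -/
theorem exists_median (ν : Measure ℝ) [IsProbabilityMeasure ν] :
    ∃ m, 1 / 2 ≤ ν.real (Set.Iic m) ∧ 1 / 2 ≤ ν.real (Set.Ici m) := by
  set S : Set ℝ := {t | 1 / 2 ≤ cdf ν t}
  have hne : S.Nonempty :=
    ((tendsto_cdf_atTop ν).eventually (eventually_ge_nhds (by norm_num))).exists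
  have hbdd : BddBelow S := by
    obtain ⟨t, ht⟩ := ((tendsto_cdf_atBot ν).eventually
      (eventually_lt_nhds (b := (1 / 2 : ℝ)) (by norm_num))).exists
    exact ⟨t, fun s hs => le_of_lt ((monotone_cdf ν).reflect_lt (lt_of_lt_of_le ht hs))⟩
  refine ⟨sInf S, ?_, ?_⟩
  · rw [← cdf_eq_real]
    have hr : Tendsto (cdf ν) (𝓝[>] (sInf S)) (𝓝 (cdf ν (sInf S))) :=
      ((cdf ν).right_continuous (sInf S)).mono_left (nhdsWithin_mono _ Set.Ioi_subset_Ici_self)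
    refine ge_of_tendsto hr (eventually_nhdsWithin_of_forall fun t ht => ?_)
    obtain ⟨s, hs, hst⟩ := exists_lt_of_csInf_lt hne ht
    exact le_trans hs (monotone_cdf ν hst.le)
  · have hl : Function.leftLim (cdf ν) (sInf S) ≤ 1 / 2 :=
      le_of_tendsto ((monotone_cdf ν).tendsto_leftLim (sInf S))
        (eventually_nhdsWithin_of_forall fun t ht =>
          le_of_lt (not_le.1 fun hS => absurd (csInf_le hbdd hS) (not_le.2 ht)))
    have h := (cdf ν).measure_Ici (tendsto_cdf_atTop ν) (sInf S)
    rw [measure_cdf] at h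
    rw [Measure.real, h, ENNReal.toReal_ofReal (by linarith)]
    linarith

theorem integrable_infDist_sq {n : ℕ} (A : Set (EuclideanSpace ℝ (Fin n))) :
    Integrable (fun g => Metric.infDist g A ^ 2) (stdGaussian _) :=
  integrable_sq_of_lipschitz (Metric.lipschitz_infDist_pt A)

/-- A closed convex cone in `ℝⁿ` has a slice by a hyperplane `inner ℝ (·) x = m` whose mean squared
distance to a Gaussian vector is within an absolute constant of that of the cone. -/
theorem exists_slice_integral_infDist_sq_le {n : ℕ} {K : Set (EuclideanSpace ℝ (Fin n))}
    (hne : K.Nonempty) (hcl : IsClosed K) (hconv : Convex ℝ K)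
    (hcone : ∀ c : ℝ, 0 ≤ c → ∀ y ∈ K, c • y ∈ K) (x : EuclideanSpace ℝ (Fin n)) :
    ∃ m : ℝ, {k | k ∈ K ∧ inner ℝ k x = m}.Nonempty ∧
      ∫ g, Metric.infDist g {k | k ∈ K ∧ inner ℝ k x = m} ^ 2 ∂(stdGaussian _) ≤
        ∫ g, Metric.infDist g K ^ 2 ∂(stdGaussian _) + 6 := by
  choose P hP using exists_isConeProj hne hcl hconv hcone
  have hPc : Continuous P := (LipschitzWith.of_dist_le_mul (K := 1) fun g g' => by
    simpa [dist_eq_norm] using (hP g).norm_sub_le (hP g')).continuous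
  set h : EuclideanSpace ℝ (Fin n) → ℝ := fun g => inner ℝ (P g) x
  have hh : Continuous h := by fun_prop
  have := Measure.isProbabilityMeasure_map (μ := stdGaussian (EuclideanSpace ℝ (Fin n)))
    hh.aemeasurable
  obtain ⟨m, hm1, hm2⟩ := exists_median ((stdGaussian _).map h)
  rw [map_measureReal_apply hh.measurable measurableSet_Iic] at hm1
  rw [map_measureReal_apply hh.measurable measurableSet_Ici] at hm2
  have hne' : ∀ A : Set (EuclideanSpace ℝ (Fin n)),
      1 / 2 ≤ (stdGaussian (EuclideanSpace ℝ (Fin n))).real A → A.Nonempty := fun A hA => by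
    rw [Set.nonempty_iff_ne_empty]
    rintro rfl
    norm_num at hA
  have hne1 := hne' _ hm1
  have hne2 := hne' _ hm2
  obtain ⟨a, ha⟩ := hne1
  obtain ⟨b, hb⟩ := hne2
  obtain ⟨z, hz, -⟩ := exists_level_dist_le hh (g := a) (a := b)
    (Set.mem_uIcc.2 (Or.inl ⟨ha, hb⟩))
  refine ⟨m, ⟨P z, (hP z).1, hz⟩, ?_⟩
  have hint := integrable_infDist_sq (n := n)
  have hA1 := integral_infDist_sq_le (hh.measurable measurableSet_Iic) hm1
  have hA2 := integral_infDist_sq_le (hh.measurable measurableSet_Ici) hm2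
  calc _ ≤ ∫ g, (Metric.infDist g K ^ 2 + (Metric.infDist g (h ⁻¹' Set.Iic m) ^ 2 +
          Metric.infDist g (h ⁻¹' Set.Ici m) ^ 2)) ∂(stdGaussian _) := by
        refine integral_mono (hint _) ((hint _).add ((hint _).add (hint _))) fun g => ?_
        exact (infDist_slice_sq_le hP hPc x ⟨z, hz⟩ g).trans
          (add_le_add_right (infDist_level_sq_le hh ⟨a, ha⟩ ⟨b, hb⟩ g) _)
    _ = ∫ g, Metric.infDist g K ^ 2 ∂(stdGaussian _) +
          (∫ g, Metric.infDist g (h ⁻¹' Set.Iic m) ^ 2 ∂(stdGaussian _) +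
          ∫ g, Metric.infDist g (h ⁻¹' Set.Ici m) ^ 2 ∂(stdGaussian _)) := by
        rw [← integral_add (hint _) (hint _)]
        exact integral_add (hint _) ((hint _).add (hint _))
    _ ≤ _ := by
        have h4 := Real.pi_lt_d2
        have h5 := Real.pi_pos
        have h6 : (Real.pi / 2) ^ 2 ≤ 3 := by nlinarith
        linarith

section TotalVariation

variable {n : ℕ} (B : Matrix (Fin (n - 1)) (Fin n) ℝ) (x : Fin n → ℝ)

theorem tv_nonneg (z : Fin n → ℝ) : 0 ≤ tv B z :=
  Finset.sum_nonneg fun _ _ => abs_nonneg _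

theorem tv_smul (c : ℝ) (z : Fin n → ℝ) : tv B (c • z) = |c| * tv B z := by
  simp only [tv, mulVec_smul, Pi.smul_apply, smul_eq_mul, abs_mul, Finset.mul_sum]

theorem mem_tvSubdiff_iff {w : Fin n → ℝ} :
    w ∈ tvSubdiff B x ↔ (∀ y, w ⬝ᵥ y ≤ tv B y) ∧ w ⬝ᵥ x = tv B x := by
  constructor
  · intro h
    have h2 := h ((2 : ℝ) • x)
    have h0 := h ((0 : ℝ) • x)
    rw [tv_smul, dotProduct_sub, dotProduct_smul, smul_eq_mul] at h2 h0
    norm_num at h2 h0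
    have hx : w ⬝ᵥ x = tv B x := by linarith
    refine ⟨fun y => ?_, hx⟩
    have := h y
    rw [dotProduct_sub] at this
    linarith
  · rintro ⟨h, hx⟩ y
    rw [dotProduct_sub]
    linarith [h y]

theorem tvSubdiff_nonempty : (tvSubdiff B x).Nonempty := by
  refine ⟨(fun i => (SignType.sign ((B *ᵥ x) i) : ℝ)) ᵥ* B,
    (mem_tvSubdiff_iff B x).2 ⟨fun y => ?_, ?_⟩⟩
  · rw [← dotProduct_mulVec]
    refine Finset.sum_le_sum fun i _ => ?_
    refine (le_abs_self _).trans ?_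
    rw [abs_mul]
    refine mul_le_of_le_one_left (abs_nonneg _) ?_
    have hsign : ∀ s : SignType, |(s : ℝ)| ≤ 1 := fun s => by cases s <;> simp
    exact hsign _
  · rw [← dotProduct_mulVec]
    exact Finset.sum_congr rfl fun i _ => sign_mul_self _

theorem mem_coneOf_tvSubdiff_iff (hx : 0 < tv B x) {y : Fin n → ℝ} :
    y ∈ coneOf (tvSubdiff B x) ↔ ∀ z, tv B x * (y ⬝ᵥ z) ≤ (y ⬝ᵥ x) * tv B z := by
  constructor
  · rintro ⟨l, u, hl, hu, rfl⟩ z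
    obtain ⟨h1, h2⟩ := (mem_tvSubdiff_iff B x).1 hu
    simp only [smul_dotProduct, smul_eq_mul, h2]
    nlinarith [mul_le_mul_of_nonneg_left (h1 z) (mul_nonneg hl hx.le)]
  · intro h
    have hnn : 0 ≤ y ⬝ᵥ x := by
      have := h ((-1 : ℝ) • x)
      rw [tv_smul, dotProduct_smul, smul_eq_mul] at this
      norm_num at this
      nlinarith
    rcases hnn.eq_or_lt with h0 | hpos
    · obtain ⟨u, hu⟩ := tvSubdiff_nonempty B x
      refine ⟨0, u, le_rfl, hu, ?_⟩
      rw [zero_smul]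
      have := h y
      rw [← h0, zero_mul] at this
      have hyy : y ⬝ᵥ y = 0 :=
        le_antisymm (by nlinarith) (Finset.sum_nonneg fun i _ => mul_self_nonneg _)
      exact dotProduct_self_eq_zero.1 hyy
    · refine ⟨(y ⬝ᵥ x) / tv B x, (tv B x / (y ⬝ᵥ x)) • y, by positivity,
        (mem_tvSubdiff_iff B x).2 ⟨fun z => ?_, ?_⟩, ?_⟩
      · rw [smul_dotProduct, smul_eq_mul, div_mul_eq_mul_div, div_le_iff₀ hpos, mul_comm (tv B z)]
        exact h z
      · rw [smul_dotProduct, smul_eq_mul, div_mul_cancel₀ _ hpos.ne']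
      · rw [smul_smul, div_mul_div_comm, mul_comm, div_self (by positivity), one_smul]

theorem smul_tvSubdiff_subset_coneOf {l : ℝ} (hl : 0 ≤ l) :
    l • tvSubdiff B x ⊆ coneOf (tvSubdiff B x) := by
  rintro _ ⟨u, hu, rfl⟩
  exact ⟨l, u, hl, hu, rfl⟩

theorem smul_tvSubdiff_mono (hx : tv B x = 0) {s t : ℝ} (hs : 0 ≤ s) (hst : s ≤ t) :
    s • tvSubdiff B x ⊆ t • tvSubdiff B x := by
  rcases (hs.trans hst).eq_or_lt with h0 | ht
  · rw [le_antisymm (hst.trans h0.ge) hs, h0]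
  rintro _ ⟨u, hu, rfl⟩
  obtain ⟨h1, h2⟩ := (mem_tvSubdiff_iff B x).1 hu
  refine ⟨(s / t) • u, (mem_tvSubdiff_iff B x).2 ⟨fun y => ?_, ?_⟩, ?_⟩
  · rw [smul_dotProduct, smul_eq_mul]
    have h3 : s / t ≤ 1 := (div_le_one ht).2 hst
    have h4 : 0 ≤ s / t := by positivity
    nlinarith [h1 y, tv_nonneg B y]
  · rw [smul_dotProduct, h2, hx, smul_zero]
  · simp only [smul_smul, mul_div_cancel₀ _ ht.ne']

theorem zero_mem_tvSubdiff (hx : tv B x = 0) : 0 ∈ tvSubdiff B x :=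
  (mem_tvSubdiff_iff B x).2 ⟨fun y => by simpa using tv_nonneg B y, by simp [hx]⟩

end TotalVariation

section GaussianDistance

variable {n : ℕ}

theorem euclDist_eq_infDist (g : EuclideanSpace ℝ (Fin n)) (C : Set (Fin n → ℝ)) :
    euclDist g.ofLp C = Metric.infDist g (WithLp.ofLp ⁻¹' C) := by
  rw [Metric.infDist_eq_iInf, euclDist]
  refine ((WithLp.equiv 2 (Fin n → ℝ)).symm.subtypeEquiv
    (p := fun u => u ∈ C) (q := fun u => u ∈ WithLp.ofLp ⁻¹' C) fun u => Iff.rfl).iInf_congr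
    fun u => ?_
  rw [EuclideanSpace.dist_eq]
  simp only [Real.dist_eq, sq_abs]
  rfl

theorem gaussD_eq_integral_infDist (C : Set (Fin n → ℝ)) :
    gaussD n C = ∫ g, Metric.infDist g (WithLp.ofLp ⁻¹' C) ^ 2
      ∂(stdGaussian (EuclideanSpace ℝ (Fin n))) := by
  rw [gaussD, stdGauss, ← map_pi_eq_stdGaussian]
  have h := integral_map_equiv (μ := Measure.pi fun _ : Fin n => gaussianReal 0 1)
    (MeasurableEquiv.toLp 2 (Fin n → ℝ))
    (fun g : EuclideanSpace ℝ (Fin n) => Metric.infDist g (WithLp.ofLp ⁻¹' C) ^ 2)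
  refine Eq.trans ?_ h.symm
  refine integral_congr_ae (ae_of_all _ fun g => ?_)
  exact congrArg (· ^ 2) (euclDist_eq_infDist (WithLp.toLp 2 g) C)

theorem gaussD_nonneg (C : Set (Fin n → ℝ)) : 0 ≤ gaussD n C :=
  integral_nonneg fun _ => sq_nonneg _

theorem integral_infDist_sq_anti {A A' : Set (EuclideanSpace ℝ (Fin n))} (hA : A.Nonempty)
    (h : A ⊆ A') :
    ∫ g, Metric.infDist g A' ^ 2 ∂(stdGaussian _) ≤
      ∫ g, Metric.infDist g A ^ 2 ∂(stdGaussian _) :=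
  integral_mono (integrable_infDist_sq _) (integrable_infDist_sq _) fun _ =>
    pow_le_pow_left₀ Metric.infDist_nonneg (Metric.infDist_le_infDist_of_subset h hA) 2

theorem gaussD_anti {C C' : Set (Fin n → ℝ)} (hC : C.Nonempty) (h : C ⊆ C') :
    gaussD n C' ≤ gaussD n C := by
  rw [gaussD_eq_integral_infDist, gaussD_eq_integral_infDist]
  exact integral_infDist_sq_anti (hC.preimage (WithLp.ofLp_surjective 2)) (Set.preimage_mono h)

variable (B : Matrix (Fin (n - 1)) (Fin n) ℝ) (x : Fin n → ℝ)

/-- At a point of positive total variation some dilate of the subdifferential is almost as close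
to a Gaussian vector as the whole cone. -/
theorem exists_gaussD_smul_tvSubdiff_le (hx : 0 < tv B x) :
    ∃ l : ℝ, 0 ≤ l ∧
      gaussD n (l • tvSubdiff B x) ≤ gaussD n (coneOf (tvSubdiff B x)) + 6 := by
  have hdot : ∀ u v : EuclideanSpace ℝ (Fin n), inner ℝ u v = u.ofLp ⬝ᵥ v.ofLp := fun u v => by
    rw [EuclideanSpace.inner_eq_star_dotProduct, star_trivial, dotProduct_comm]
  set K : Set (EuclideanSpace ℝ (Fin n)) := WithLp.ofLp ⁻¹' coneOf (tvSubdiff B x)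
  have hKeq : K = ⋂ z : Fin n → ℝ, {y : EuclideanSpace ℝ (Fin n) |
      tv B x * (y.ofLp ⬝ᵥ z) ≤ (y.ofLp ⬝ᵥ x) * tv B z} := by
    ext y
    simp only [Set.mem_iInter]
    exact mem_coneOf_tvSubdiff_iff B x hx
  have hne : K.Nonempty := by
    obtain ⟨u, hu⟩ := tvSubdiff_nonempty B x
    exact ⟨WithLp.toLp 2 u, 1, u, zero_le_one, hu, (one_smul _ _).symm⟩
  have hcont : ∀ z : Fin n → ℝ, Continuous fun y : EuclideanSpace ℝ (Fin n) => y.ofLp ⬝ᵥ z :=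
    fun z => by unfold dotProduct; fun_prop
  have hcl : IsClosed K := by
    rw [hKeq]
    exact isClosed_iInter fun z => isClosed_le ((hcont z).const_mul _) ((hcont x).mul_const _)
  have hconv : Convex ℝ K := by
    rw [hKeq]
    refine convex_iInter fun z => fun u hu v hv a b ha hb _ => ?_
    rw [Set.mem_ofPred_eq] at hu hv
    have h1 := mul_le_mul_of_nonneg_left hu ha
    have h2 := mul_le_mul_of_nonneg_left hv hb
    simp only [Set.mem_ofPred_eq, WithLp.ofLp_add, WithLp.ofLp_smul, add_dotProduct,
      smul_dotProduct, smul_eq_mul]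
    linarith
  have hcone : ∀ c : ℝ, 0 ≤ c → ∀ y ∈ K, c • y ∈ K := by
    rintro c hc y ⟨l, u, hl, hu, hy⟩
    exact ⟨c * l, u, mul_nonneg hc hl, hu, by rw [WithLp.ofLp_smul, hy, smul_smul]⟩
  obtain ⟨m, hne', hle⟩ :=
    exists_slice_integral_infDist_sq_le hne hcl hconv hcone (WithLp.toLp 2 x)
  have hslice : ∀ (l : ℝ) (u k : Fin n → ℝ), u ∈ tvSubdiff B x → k = l • u → k ⬝ᵥ x = m →
      l = m / tv B x := by
    rintro l u _ hu rfl hm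
    rw [smul_dotProduct, ((mem_tvSubdiff_iff B x).1 hu).2, smul_eq_mul] at hm
    rw [← hm, mul_div_cancel_right₀ _ hx.ne']
  refine ⟨m / tv B x, ?_, ?_⟩
  · obtain ⟨k, ⟨l, u, hl, hu, hk⟩, hkm⟩ := hne'
    rw [hdot] at hkm
    rwa [← hslice l u _ hu hk hkm]
  · rw [gaussD_eq_integral_infDist, gaussD_eq_integral_infDist]
    refine (integral_infDist_sq_anti hne' ?_).trans hle
    rintro k ⟨⟨l, u, hl, hu, hk⟩, hkm⟩
    rw [hdot] at hkm
    exact ⟨u, hu, by simp only; rw [← hslice l u _ hu hk hkm, hk]⟩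

/-- At a point of zero total variation the dilates of the subdifferential exhaust the cone. -/
theorem tendsto_gaussD_smul_tvSubdiff (hx : tv B x = 0) :
    Tendsto (fun k : ℕ => gaussD n ((k : ℝ) • tvSubdiff B x)) atTop
      (𝓝 (gaussD n (coneOf (tvSubdiff B x)))) := by
  simp_rw [gaussD_eq_integral_infDist]
  have hz : ∀ k : ℕ, (0 : EuclideanSpace ℝ (Fin n)) ∈
      (WithLp.ofLp ⁻¹' ((k : ℝ) • tvSubdiff B x) : Set (EuclideanSpace ℝ (Fin n))) := fun k =>
    ⟨0, zero_mem_tvSubdiff B x hx, by simp⟩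
  refine tendsto_integral_of_dominated_convergence (fun g => ‖g‖ ^ 2)
    (fun k => (integrable_infDist_sq _).aestronglyMeasurable) ?_
    (fun k => ae_of_all _ fun g => ?_) (ae_of_all _ fun g => ?_)
  · exact (IsGaussian.memLp_two_id (μ := stdGaussian (EuclideanSpace ℝ (Fin n)))).norm.integrable_sq
  · rw [norm_pow, Real.norm_eq_abs, abs_of_nonneg Metric.infDist_nonneg]
    refine pow_le_pow_left₀ Metric.infDist_nonneg ?_ 2
    simpa using Metric.infDist_le_dist_of_mem (x := g) (hz k)
  · refine Tendsto.pow ?_ 2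
    refine tendsto_order.2 ⟨fun a ha => Eventually.of_forall fun k => ?_, fun a ha => ?_⟩
    · exact ha.trans_le (Metric.infDist_le_infDist_of_subset
        (Set.preimage_mono (smul_tvSubdiff_subset_coneOf B x k.cast_nonneg)) ⟨0, hz k⟩)
    · have hne : (WithLp.ofLp ⁻¹' coneOf (tvSubdiff B x) :
          Set (EuclideanSpace ℝ (Fin n))).Nonempty :=
        ⟨0, 0, 0, le_rfl, zero_mem_tvSubdiff B x hx, by simp⟩
      obtain ⟨u, ⟨l, v, hl, hv, hu⟩, hua⟩ := (Metric.infDist_lt_iff hne).1 ha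
      filter_upwards [tendsto_natCast_atTop_atTop.eventually_ge_atTop l] with k hk
      refine (Metric.infDist_le_dist_of_mem ?_).trans_lt hua
      exact smul_tvSubdiff_mono B x hx hl hk ⟨v, hv, hu.symm⟩

end GaussianDistance

/-- `D(cone(∂f(x))) ≤ inf_{λ ≥ 0} D(λ ∂f(x)) ≤ D(cone(∂f(x))) + 6` for the total variation
subdifferential. -/
theorem tv_D_cone_le_inf_D_le_D_cone_add_six (n : ℕ) (hn : 2 ≤ n)
    (B : Matrix (Fin (n - 1)) (Fin n) ℝ)
    (hB : ∀ (i : Fin (n - 1)) (j : Fin n),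
      B i j = if j = fdIdx0 i then 1 else if j = fdIdx1 i then -1 else 0)
    (x : Fin n → ℝ) (hx : x ≠ 0) :
    gaussD n (coneOf (tvSubdiff B x)) ≤
        (⨅ l : {l : ℝ // 0 ≤ l}, gaussD n ((l : ℝ) • tvSubdiff B x)) ∧
      (⨅ l : {l : ℝ // 0 ≤ l}, gaussD n ((l : ℝ) • tvSubdiff B x)) ≤
        gaussD n (coneOf (tvSubdiff B x)) + 6 := by
  have hbdd : BddBelow (Set.range fun l : {l : ℝ // 0 ≤ l} =>
      gaussD n ((l : ℝ) • tvSubdiff B x)) :=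
    ⟨0, by rintro _ ⟨l, rfl⟩; exact gaussD_nonneg _⟩
  have : Nonempty {l : ℝ // 0 ≤ l} := ⟨⟨0, le_rfl⟩⟩
  refine ⟨le_ciInf fun l => ?_, ?_⟩
  · exact gaussD_anti (tvSubdiff_nonempty B x).smul_set (smul_tvSubdiff_subset_coneOf B x l.2)
  · rcases (tv_nonneg B x).eq_or_lt with h0 | hpos
    · have hle := ge_of_tendsto' (tendsto_gaussD_smul_tvSubdiff B x h0.symm) fun k =>
        ciInf_le hbdd ⟨(k : ℝ), k.cast_nonneg⟩
      linarith
    · obtain ⟨l, hl, hle⟩ := exists_gaussD_smul_tvSubdiff_le B x hpos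
      exact (ciInf_le hbdd ⟨l, hl⟩).trans hle
end
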